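/- arXiv:1909.09951 — 6 statements merged into one kernel-verified Lean document; each statement's English description precedes it below -/
import Mathlib

section
/- Let p ≥ 5 be a prime. Let A : ZMod p be an element that is not a square, and let B : ZMod p be nonzero. Then there exists y : ZMod p such that A − B·y² is a nonzero square, i.e. there exists s : ZMod p with s ≠ 0 and A − B·y² = s². -/
open Polynomial in
/-- Over `ZMod p` with `p` an odd prime, a conic `x ^ 2 + b * y ^ 2 = a` with `b ≠ 0` has a point. -/
theorem ZMod.exists_sq_add_mul_sq {p : ℕ} [Fact p.Prime] (hp2 : p ≠ 2) (a : ZMod p) {b : ZMod p}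
    (hb : b ≠ 0) : ∃ x y : ZMod p, x ^ 2 + b * y ^ 2 = a := by
  have hodd : Fintype.card (ZMod p) % 2 = 1 := by
    rw [ZMod.card]
    exact (Fact.out : p.Prime).eq_two_or_odd.resolve_left hp2
  have hf : degree (X ^ 2 : (ZMod p)[X]) = 2 := degree_X_pow 2
  have hg : degree (C b * X ^ 2 + C 0 * X + C (-a) : (ZMod p)[X]) = 2 := degree_quadratic hb
  obtain ⟨x, y, h⟩ := FiniteField.exists_root_sum_quadratic hf hg hodd
  refine ⟨x, y, ?_⟩
  simp only [eval_add, eval_mul, eval_pow, eval_X, eval_C] at h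
  linear_combination h

/-- The line of slope parameter `t` through the point `(0, y)` of the conic
`s ^ 2 + b * z ^ 2 = b * y ^ 2` meets it in a second point whose first coordinate is nonzero. -/
theorem exists_ne_zero_mul_sq_sub_mul_sq {K : Type*} [Field K] {b y t : K} (h2 : (2 : K) ≠ 0)
    (hb : b ≠ 0) (hy : y ≠ 0) (ht : t ≠ 0) (hbt : 1 + b * t ^ 2 ≠ 0) :
    ∃ z s : K, s ≠ 0 ∧ b * y ^ 2 - b * z ^ 2 = s ^ 2 := by
  refine ⟨y - t * (2 * b * y * t / (1 + b * t ^ 2)), 2 * b * y * t / (1 + b * t ^ 2),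
    div_ne_zero (mul_ne_zero (mul_ne_zero (mul_ne_zero h2 hb) hy) ht) hbt, ?_⟩
  field_simp
  ring

/-- Let `p ≥ 5` be a prime, `A : ZMod p` not a square and `B : ZMod p` nonzero.
Then there is `y : ZMod p` with `A - B * y ^ 2` a nonzero square. -/
theorem stmt_1 (p : ℕ) (hp : p.Prime) (hp5 : 5 ≤ p) (A B : ZMod p)
    (hA : ¬ ∃ s : ZMod p, A = s ^ 2) (hB : B ≠ 0) :
    ∃ y : ZMod p, ∃ s : ZMod p, s ≠ 0 ∧ A - B * y ^ 2 = s ^ 2 := by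
  have : Fact p.Prime := ⟨hp⟩
  obtain ⟨s, y, h⟩ := ZMod.exists_sq_add_mul_sq (by lia) A hB
  by_cases hs : s = 0
  · have hAy : A = B * y ^ 2 := by rw [← h, hs]; ring
    have hy : y ≠ 0 := by
      rintro rfl
      exact hA ⟨0, by rw [hAy]; ring⟩
    have h2 : (2 : ZMod p) ≠ 0 := by
      intro h0
      have := Nat.le_of_dvd (by norm_num) ((ZMod.natCast_eq_zero_iff 2 p).1 (by exact_mod_cast h0))
      lia
    have h3 : (3 : ZMod p) ≠ 0 := by
      intro h0
      have := Nat.le_of_dvd (by norm_num) ((ZMod.natCast_eq_zero_iff 3 p).1 (by exact_mod_cast h0))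
      lia
    rw [hAy]
    by_cases h1 : 1 + B * 1 ^ 2 = 0
    · refine exists_ne_zero_mul_sq_sub_mul_sq h2 hB hy h2 fun h4 => h3 ?_
      linear_combination 4 * h1 - h4
    · exact exists_ne_zero_mul_sq_sub_mul_sq h2 hB hy one_ne_zero h1
  · exact ⟨y, s, hs, by rw [← h]; ring⟩
end

section
/- Let p be a prime. If for every y : ZMod p the element y² − 1 is a square in ZMod p, then every element of ZMod p is a square. -/
/-- If the squares of a ring are stable under subtracting `1`, the negative of every natural
number is a square. -/
theorem exists_neg_natCast_eq_sq {R : Type*} [Ring R]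
    (h : ∀ y : R, ∃ s : R, y ^ 2 - 1 = s ^ 2) (n : ℕ) : ∃ s : R, -(n : R) = s ^ 2 := by
  induction n with
  | zero => exact ⟨0, by simp⟩
  | succ n ih =>
    obtain ⟨y, hy⟩ := ih
    obtain ⟨s, hs⟩ := h y
    exact ⟨s, by rw [← hs, ← hy, Nat.cast_succ, neg_add, sub_eq_add_neg]⟩

/-- Let `p` be a prime. If for every `y : ZMod p` the element `y ^ 2 - 1` is a square,
then every element of `ZMod p` is a square. -/
theorem stmt_4 (p : ℕ) (hp : p.Prime)
    (h : ∀ y : ZMod p, ∃ s : ZMod p, y ^ 2 - 1 = s ^ 2) :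
    ∀ x : ZMod p, ∃ s : ZMod p, x = s ^ 2 := by
  intro x
  have : NeZero p := ⟨hp.ne_zero⟩
  simpa using exists_neg_natCast_eq_sq h (-x).val
end

section
/- Let p be an odd prime. If for every y : ZMod p the element 1 − y² is a square in ZMod p, then −1 is not a square in ZMod p. -/
/-- Let `p` be an odd prime. If for every `y : ZMod p` the element `1 - y ^ 2` is a square,
then `-1` is not a square in `ZMod p`. -/
theorem stmt_5 (p : ℕ) (hp : p.Prime) (hodd : p ≠ 2)
    (h : ∀ y : ZMod p, ∃ s : ZMod p, 1 - y ^ 2 = s ^ 2) :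
    ¬ ∃ s : ZMod p, (-1 : ZMod p) = s ^ 2 := by
  rintro ⟨i, hi⟩
  have : Fact p.Prime := ⟨hp⟩
  have natCast_sq : ∀ n : ℕ, ∃ s : ZMod p, (n : ZMod p) = s ^ 2 := by
    intro n
    induction n with
    | zero => exact ⟨0, by simp⟩
    | succ n ih =>
      obtain ⟨s, hs⟩ := ih
      obtain ⟨t, ht⟩ := h (i * s)
      refine ⟨t, ?_⟩
      rw [← ht, mul_pow, ← hi, ← hs]
      push_cast
      ring
  obtain ⟨a, ha⟩ := FiniteField.exists_nonsquare (F := ZMod p) (by rwa [ZMod.ringChar_zmod_n])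
  obtain ⟨s, hs⟩ := natCast_sq a.val
  rw [ZMod.natCast_zmod_val] at hs
  exact ha ⟨s, by rw [hs, sq]⟩
end

section
/- Let p be an odd prime, M a module over ZMod p, and B : M → M → ZMod p a symmetric bilinear form. Let ω : M with B ω ω ≠ 0, and let δ₁, δ₂ : M with B δ₁ δ₂ = 0, B δ₁ δ₁ = −2, and B δ₂ δ₂ = −2. Then there exists δ : M such that B ω ω · B δ δ − (B ω δ)² ≠ 0. -/
/-- Let `p` be an odd prime, `M` a `ZMod p`-module, `B` a symmetric bilinear form on `M`,
`ω : M` with `B ω ω ≠ 0`, and `δ₁ δ₂ : M` with `B δ₁ δ₂ = 0`, `B δ₁ δ₁ = -2`,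
`B δ₂ δ₂ = -2`. Then there is `δ : M` with `B ω ω * B δ δ - (B ω δ) ^ 2 ≠ 0`. -/
theorem stmt_7 (p : ℕ) (hp : p.Prime) (hodd : p ≠ 2)
    (M : Type*) [AddCommGroup M] [Module (ZMod p) M]
    (B : M →ₗ[ZMod p] M →ₗ[ZMod p] ZMod p) (hsymm : ∀ x y : M, B x y = B y x)
    (ω : M) (hω : B ω ω ≠ 0)
    (δ₁ δ₂ : M) (h12 : B δ₁ δ₂ = 0) (h11 : B δ₁ δ₁ = -2) (h22 : B δ₂ δ₂ = -2) :
    ∃ δ : M, B ω ω * B δ δ - (B ω δ) ^ 2 ≠ 0 := by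
  have : Fact p.Prime := ⟨hp⟩
  have two_ne : (2 : ZMod p) ≠ 0 := Ring.two_ne_zero (by rwa [ZMod.ringChar_zmod_n])
  by_contra! h
  have h₁ := h δ₁
  have h₂ := h δ₂
  have h₃ := h (δ₁ + δ₂)
  simp only [map_add, LinearMap.add_apply, hsymm δ₂ δ₁, h12, h11, h22] at h₁ h₂ h₃
  have cross : 2 * (B ω δ₁ * B ω δ₂) = 0 := by linear_combination h₁ + h₂ - h₃
  have hprod : B ω δ₁ * B ω δ₂ = 0 := (mul_eq_zero.mp cross).resolve_left two_ne
  have hzero : 2 * B ω ω = 0 := by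
    rcases mul_eq_zero.mp hprod with h₀ | h₀
    · linear_combination -h₁ - B ω δ₁ * h₀
    · linear_combination -h₂ - B ω δ₂ * h₀
  exact hω ((mul_eq_zero.mp hzero).resolve_left two_ne)
end

section
/- Let p ≥ 5 be a prime, M a module over ZMod p, and B : M → M → ZMod p a symmetric bilinear form. Let ω₁ : M with B ω₁ ω₁ ≠ 0, let δ₁, δ₂ : M with B δ₁ δ₂ = 0, B δ₁ δ₁ = −2, B δ₂ δ₂ = −2, and let ω₂ : M be arbitrary. Then there exist δ : M and y : ZMod p with y ≠ 0 such that B ω₁ ω₁ · B (ω₂ + y•δ) (ω₂ + y•δ) − (B ω₁ (ω₂ + y•δ))² ≠ 0. -/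
/-- Let `p ≥ 5` be a prime, `M` a `ZMod p`-module, `B` a symmetric bilinear form on `M`,
`ω₁ : M` with `B ω₁ ω₁ ≠ 0`, `δ₁ δ₂ : M` with `B δ₁ δ₂ = 0`, `B δ₁ δ₁ = -2`,
`B δ₂ δ₂ = -2`, and `ω₂ : M` arbitrary. Then there exist `δ : M` and `y ≠ 0` with
`B ω₁ ω₁ * B (ω₂ + y • δ) (ω₂ + y • δ) - (B ω₁ (ω₂ + y • δ)) ^ 2 ≠ 0`. -/
theorem stmt_8 (p : ℕ) (hp : p.Prime) (hp5 : 5 ≤ p)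
    (M : Type*) [AddCommGroup M] [Module (ZMod p) M]
    (B : M →ₗ[ZMod p] M →ₗ[ZMod p] ZMod p) (hsymm : ∀ x y : M, B x y = B y x)
    (ω₁ : M) (hω₁ : B ω₁ ω₁ ≠ 0)
    (δ₁ δ₂ : M) (h12 : B δ₁ δ₂ = 0) (h11 : B δ₁ δ₁ = -2) (h22 : B δ₂ δ₂ = -2)
    (ω₂ : M) :
    ∃ δ : M, ∃ y : ZMod p, y ≠ 0 ∧
      B ω₁ ω₁ * B (ω₂ + y • δ) (ω₂ + y • δ) - (B ω₁ (ω₂ + y • δ)) ^ 2 ≠ 0 := by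
  have : Fact p.Prime := ⟨hp⟩
  have two_ne : (2 : ZMod p) ≠ 0 := by
    intro h
    have hdvd : p ∣ 2 := (ZMod.natCast_eq_zero_iff 2 p).mp (by exact_mod_cast h)
    have := Nat.le_of_dvd (by norm_num) hdvd
    omega
  by_contra! hcon
  have hgram (v : M) : B ω₁ ω₁ * B v v - (B ω₁ v) ^ 2 = 0 := by
    simpa using hcon (v - ω₂) 1 one_ne_zero
  have h₁ := hgram δ₁
  have h₂ := hgram δ₂
  have h₁₂ := hgram (δ₁ + δ₂)
  have h21 : B δ₂ δ₁ = 0 := (hsymm δ₂ δ₁).trans h12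
  simp only [map_add, LinearMap.add_apply, h11, h22, h12, h21] at h₁ h₂ h₁₂
  have hprod : B ω₁ δ₁ * B ω₁ δ₂ = 0 := by
    refine (mul_eq_zero.mp ?_).resolve_left two_ne
    linear_combination h₁ + h₂ - h₁₂
  have hzero : 2 * B ω₁ ω₁ = 0 := by
    rcases mul_eq_zero.mp hprod with h | h
    · rw [h] at h₁
      linear_combination -h₁
    · rw [h] at h₂
      linear_combination -h₂
  exact hω₁ ((mul_eq_zero.mp hzero).resolve_left two_ne)
end

section
/- Let p be an odd prime, V a finite-dimensional vector space over ZMod p, and B : V → V → ZMod p a nondegenerate symmetric bilinear form. Let ω₁, ω₂, η : V satisfy B ω₁ ω₁ ≠ 0, B ω₂ ω₂ ≠ 0, B ω₁ ω₂ = 0, B η ω₁ = 0, B η ω₂ = 0, and η ≠ 0. Then there exist y : ZMod p and δ : V such that B δ ω₁ = 0, B δ (ω₂ + y•η) = 0, and B δ δ ≠ 0. -/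
/-- Let `p` be an odd prime, `V` a finite-dimensional `ZMod p`-vector space, and `B` a
nondegenerate symmetric bilinear form on `V`. Let `ω₁ ω₂ η : V` satisfy `B ω₁ ω₁ ≠ 0`,
`B ω₂ ω₂ ≠ 0`, `B ω₁ ω₂ = 0`, `B η ω₁ = 0`, `B η ω₂ = 0`, and `η ≠ 0`. Then there exist
`y : ZMod p` and `δ : V` with `B δ ω₁ = 0`, `B δ (ω₂ + y • η) = 0`, and `B δ δ ≠ 0`. -/
theorem stmt_10 (p : ℕ) (hp : p.Prime) (hodd : p ≠ 2) [Fact p.Prime]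
    (V : Type*) [AddCommGroup V] [Module (ZMod p) V] [FiniteDimensional (ZMod p) V]
    (B : V →ₗ[ZMod p] V →ₗ[ZMod p] ZMod p) (hsymm : ∀ x y : V, B x y = B y x)
    (hnd : ∀ v : V, (∀ w : V, B v w = 0) → v = 0)
    (ω₁ ω₂ η : V) (hω₁ : B ω₁ ω₁ ≠ 0) (hω₂ : B ω₂ ω₂ ≠ 0) (h12 : B ω₁ ω₂ = 0)
    (hη₁ : B η ω₁ = 0) (hη₂ : B η ω₂ = 0) (hη : η ≠ 0) :
    ∃ y : ZMod p, ∃ δ : V, B δ ω₁ = 0 ∧ B δ (ω₂ + y • η) = 0 ∧ B δ δ ≠ 0 := by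
  have h21 : B ω₂ ω₁ = 0 := by rw [hsymm, h12]
  have two_ne : (2 : ZMod p) ≠ 0 := Ring.two_ne_zero (by rwa [ZMod.ringChar_zmod_n])
  suffices h : ∃ δ : V, B δ ω₁ = 0 ∧ B δ ω₂ = 0 ∧ B δ δ ≠ 0 by
    obtain ⟨δ, h₁, h₂, h₃⟩ := h
    exact ⟨0, δ, h₁, by simpa using h₂, h₃⟩
  by_cases hηη : B η η = 0
  swap
  · exact ⟨η, hη₁, hη₂, hηη⟩
  obtain ⟨w, hw⟩ : ∃ w, B η w ≠ 0 := by
    by_contra! h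
    exact hη (hnd η h)
  obtain ⟨d, hd₁, hd₂, hηd⟩ : ∃ d : V, B d ω₁ = 0 ∧ B d ω₂ = 0 ∧ B η d ≠ 0 := by
    refine ⟨w - (B w ω₁ / B ω₁ ω₁) • ω₁ - (B w ω₂ / B ω₂ ω₂) • ω₂, ?_, ?_, ?_⟩
    · simp [h21, hω₁]
    · simp [h12, hω₂]
    · simpa [hη₁, hη₂] using hw
  by_cases hdd : B d d = 0
  swap
  · exact ⟨d, hd₁, hd₂, hdd⟩
  refine ⟨η + d, by simp [hη₁, hd₁], by simp [hη₂, hd₂], ?_⟩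
  have hsq : B (η + d) (η + d) = 2 * B η d := by
    simp only [map_add, LinearMap.add_apply, hηη, hdd, hsymm d η]
    ring
  rw [hsq]
  exact mul_ne_zero two_ne hηd
end
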